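/- Let d ≥ 3. There exists a constant C > 0 such that for every L ≥ 1, every x ∈ V_L and every y ∈ ∂V_L, the exit measure of simple random walk from V_L satisfies C^{-1}·d_L(x)/|x-y|^d ≤ π_L(x,y) ≤ C·max{1, d_L(x)}/|x-y|^d, where d_L(x) = L - |x|. -/

import Mathlib

open MeasureTheory

/-- Euclidean norm of a lattice point in `ℤ^d`. -/
noncomputable def znorm {d : ℕ} (x : Fin d → ℤ) : ℝ := Real.sqrt (∑ i, ((x i : ℝ)) ^ 2)

/-- A (time-homogeneous) Markov chain: a family of path-space laws `P x` which are
probability measures started at `x` and satisfy the Markov property. -/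
def IsMarkovChain {S : Type*} [MeasurableSpace S]
    (P : S → Measure (ℕ → S)) : Prop :=
  (∀ x, IsProbabilityMeasure (P x)) ∧
  (∀ x, P x {ω | ω 0 = x} = 1) ∧
  (∀ (x : S) (n : ℕ) (A B : Set (ℕ → S)), MeasurableSet A → MeasurableSet B →
    (∀ ω ω' : ℕ → S, (∀ k ≤ n, ω k = ω' k) → (ω ∈ A ↔ ω' ∈ A)) →
    P x (A ∩ {ω | (fun k => ω (n + k)) ∈ B}) = ∫⁻ ω in A, P (ω n) B ∂(P x))

/-- Simple random walk on `ℤ^d`. -/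
def IsSRW (d : ℕ) (P : (Fin d → ℤ) → Measure (ℕ → Fin d → ℤ)) : Prop :=
  IsMarkovChain P ∧
  ∀ x y : Fin d → ℤ,
    P x {ω | ω 1 = y} = if znorm (y - x) = 1 then ENNReal.ofReal (1 / (2 * d)) else 0

theorem exists_rpow_cubic_approx (β : ℝ) :
    ∃ a C η : ℝ, 0 < C ∧ 0 < η ∧ ∀ q : ℝ, |q| ≤ η →
      |(1 + q) ^ (-β) - (1 - β * q + β * (β + 1) / 2 * q ^ 2 + a * q ^ 3)| ≤ C * q ^ 4 := by
  have h := (Real.one_add_rpow_hasFPowerSeriesAt_zero (a := -β)).isBigO_sub_partialSum_pow 4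
  obtain ⟨C, hC, hb⟩ := h.exists_pos
  rw [Asymptotics.isBigOWith_iff, Metric.eventually_nhds_iff] at hb
  obtain ⟨η, hη, hb⟩ := hb
  refine ⟨Ring.choose (-β) 3, C, η / 2, hC, by positivity, fun q hq => ?_⟩
  have h2 : Ring.choose (-β) 2 = β * (β + 1) / 2 := by
    have := Ring.descPochhammer_eq_factorial_smul_choose (-β) 2
    simp [descPochhammer_succ_right, Polynomial.smeval_mul, Polynomial.smeval_sub,
      Polynomial.smeval_X, Polynomial.smeval_one, Nat.factorial] at this
    linarith
  have := hb (y := q) (by rw [dist_zero_right, Real.norm_eq_abs]; linarith)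
  simp only [FormalMultilinearSeries.partialSum, Finset.sum_range_succ, Finset.sum_range_zero,
    binomialSeries_apply, zero_add, Ring.choose_zero_right, Ring.choose_one_right, h2] at this
  simp only [Real.norm_eq_abs, abs_pow, abs_abs] at this
  simp at this
  rw [← abs_pow, abs_of_nonneg (by positivity : 0 ≤ q ^ 4)] at this
  convert this using 2
  ring

set_option maxHeartbeats 1000000 in
theorem exists_rpow_symm_difference_bounds (β : ℝ) :
    ∃ C R : ℝ, 0 < C ∧ 1 ≤ R ∧ ∀ u t : ℝ, |u| ≤ 1 → 0 < t → t * R ≤ 1 →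
      0 < 1 + (t ^ 2 + 2 * u * t) ∧ 0 < 1 + (t ^ 2 - 2 * u * t) ∧
      |(1 + (t ^ 2 + 2 * u * t)) ^ (-β) + (1 + (t ^ 2 - 2 * u * t)) ^ (-β) - 2
        - (-2 * β * t ^ 2 + 4 * β * (β + 1) * u ^ 2 * t ^ 2)| ≤ C * t ^ 4 ∧
      |(1 + (t ^ 2 + 2 * u * t)) ^ (-β) - (1 + (t ^ 2 - 2 * u * t)) ^ (-β)
        + 4 * β * u * t| ≤ C * t ^ 3 ∧
      |(1 + (t ^ 2 + 2 * u * t)) ^ (-β) + (1 + (t ^ 2 - 2 * u * t)) ^ (-β) - 2| ≤ C * t ^ 2 := by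
  obtain ⟨a, C, η, hC, hη, hP⟩ := exists_rpow_cubic_approx β
  set κ := β * (β + 1) / 2 with hκ
  refine ⟨162 * C + 2 * |β| + 10 * |κ| + 28 * |a|, max 4 (3 / η), by positivity,
    le_max_of_le_left (by norm_num), fun u t hu ht htR => ?_⟩
  have h4 : t * 4 ≤ 1 := (mul_le_mul_of_nonneg_left (le_max_left _ _) ht.le).trans htR
  have hη' : 3 * t ≤ η := by
    have := (mul_le_mul_of_nonneg_left (le_max_right 4 (3 / η)) ht.le).trans htR
    rw [mul_div_assoc', div_le_one hη] at this
    linarith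
  have ht1 : t ≤ 1 := by linarith
  have ht2 : t ^ 2 ≤ t := by nlinarith
  have ht3 : t ^ 3 ≤ t ^ 2 := pow_le_pow_of_le_one ht.le ht1 (by norm_num)
  have ht43 : t ^ 4 ≤ t ^ 3 := pow_le_pow_of_le_one ht.le ht1 (by norm_num)
  have ht53 : t ^ 5 ≤ t ^ 3 := pow_le_pow_of_le_one ht.le ht1 (by norm_num)
  have ht64 : t ^ 6 ≤ t ^ 4 := pow_le_pow_of_le_one ht.le ht1 (by norm_num)
  obtain ⟨hu1, hu2⟩ := abs_le.1 hu
  have hut : |u * t| ≤ t := by rw [abs_mul, abs_of_pos ht]; nlinarith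
  obtain ⟨hut1, hut2⟩ := abs_le.1 hut
  have hq : ∀ q : ℝ, |q| ≤ 3 * t →
      |(1 + q) ^ (-β) - (1 - β * q + κ * q ^ 2 + a * q ^ 3)| ≤ 81 * C * t ^ 4 := by
    intro q hq
    refine (hP q (hq.trans hη')).trans ?_
    have : q ^ 4 ≤ (3 * t) ^ 4 := by
      rw [← Even.pow_abs (by decide : Even 4) q]
      exact pow_le_pow_left₀ (abs_nonneg _) hq 4
    nlinarith
  have e1 := hq (t ^ 2 + 2 * u * t) (abs_le.2 ⟨by nlinarith, by nlinarith⟩)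
  have e2 := hq (t ^ 2 - 2 * u * t) (abs_le.2 ⟨by nlinarith, by nlinarith⟩)
  refine ⟨by nlinarith, by nlinarith, ?_⟩
  set p := (1 + (t ^ 2 + 2 * u * t)) ^ (-β)
  set m := (1 + (t ^ 2 - 2 * u * t)) ^ (-β)
  have hu2' : u ^ 2 ≤ 1 := by nlinarith
  have hk : ∀ c : ℝ, ∀ s, |s| ≤ 1 → |c * s| ≤ |c| := fun c s hs => by
    rw [abs_mul]; nlinarith [abs_nonneg c]
  have hm : ∀ c s B : ℝ, 0 ≤ s → s ≤ B → |c * s| ≤ |c| * B := fun c s B hs hB => by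
    rw [abs_mul, abs_of_nonneg hs]; gcongr
  have S : |p + m - 2 - (-2 * β * t ^ 2 + 4 * β * (β + 1) * u ^ 2 * t ^ 2)|
      ≤ (162 * C + 2 * |κ| + 26 * |a|) * t ^ 4 := by
    have : p + m - 2 - (-2 * β * t ^ 2 + 4 * β * (β + 1) * u ^ 2 * t ^ 2)
      = (p - (1 - β * (t ^ 2 + 2 * u * t) + κ * (t ^ 2 + 2 * u * t) ^ 2
          + a * (t ^ 2 + 2 * u * t) ^ 3))
        + (m - (1 - β * (t ^ 2 - 2 * u * t) + κ * (t ^ 2 - 2 * u * t) ^ 2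
          + a * (t ^ 2 - 2 * u * t) ^ 3)) + (κ * (2 * t ^ 4)
          + a * (2 * t ^ 6 + 24 * u ^ 2 * t ^ 4)) := by rw [hκ]; ring
    rw [this]
    refine (abs_add_three _ _ _).trans ?_
    have h1 : |κ * (2 * t ^ 4) + a * (2 * t ^ 6 + 24 * u ^ 2 * t ^ 4)|
        ≤ |κ| * (2 * t ^ 4) + |a| * (26 * t ^ 4) := by
      refine (abs_add_le _ _).trans (add_le_add (hm _ _ _ (by positivity) le_rfl)
        (hm _ _ _ (by positivity) ?_))
      nlinarith [mul_le_mul_of_nonneg_right hu2' (by positivity : 0 ≤ t ^ 4)]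
    linarith
  have Df : |p - m + 4 * β * u * t| ≤ (162 * C + 8 * |κ| + 28 * |a|) * t ^ 3 := by
    have : p - m + 4 * β * u * t
      = (p - (1 - β * (t ^ 2 + 2 * u * t) + κ * (t ^ 2 + 2 * u * t) ^ 2
          + a * (t ^ 2 + 2 * u * t) ^ 3))
        - (m - (1 - β * (t ^ 2 - 2 * u * t) + κ * (t ^ 2 - 2 * u * t) ^ 2
          + a * (t ^ 2 - 2 * u * t) ^ 3)) + u * (κ * (8 * t ^ 3)
          + a * (16 * u ^ 2 * t ^ 3 + 12 * t ^ 5)) := by ring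
    rw [this]
    refine (abs_add_le _ _).trans ?_
    have h1 : |u * (κ * (8 * t ^ 3) + a * (16 * u ^ 2 * t ^ 3 + 12 * t ^ 5))|
        ≤ |κ| * (8 * t ^ 3) + |a| * (28 * t ^ 3) := by
      rw [mul_comm]
      refine (hk _ _ hu).trans ((abs_add_le _ _).trans (add_le_add
        (hm _ _ _ (by positivity) le_rfl) (hm _ _ _ (by positivity) ?_)))
      nlinarith [mul_le_mul_of_nonneg_right hu2' (by positivity : 0 ≤ t ^ 3)]
    have h2 := abs_sub (p - (1 - β * (t ^ 2 + 2 * u * t) + κ * (t ^ 2 + 2 * u * t) ^ 2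
          + a * (t ^ 2 + 2 * u * t) ^ 3)) (m - (1 - β * (t ^ 2 - 2 * u * t)
          + κ * (t ^ 2 - 2 * u * t) ^ 2 + a * (t ^ 2 - 2 * u * t) ^ 3))
    nlinarith [mul_le_mul_of_nonneg_left ht43 hC.le]
  refine ⟨S.trans ?_, Df.trans ?_, ?_⟩
  · gcongr ?_ * _
    linarith [abs_nonneg β, abs_nonneg κ, abs_nonneg a]
  · gcongr ?_ * _
    linarith [abs_nonneg β, abs_nonneg κ, abs_nonneg a]
  · have : p + m - 2 = (p + m - 2 - (-2 * β * t ^ 2 + 4 * β * (β + 1) * u ^ 2 * t ^ 2))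
        + (-(β * (2 * t ^ 2)) + κ * (8 * u ^ 2 * t ^ 2)) := by rw [hκ]; ring
    rw [this]
    refine (abs_add_le _ _).trans ?_
    have h1 : |-(β * (2 * t ^ 2)) + κ * (8 * u ^ 2 * t ^ 2)|
        ≤ |β| * (2 * t ^ 2) + |κ| * (8 * t ^ 2) := by
      refine (abs_add_le _ _).trans (add_le_add (by
        rw [abs_neg]; exact hm _ _ _ (by positivity) le_rfl) (hm _ _ _ (by positivity) ?_))
      linarith [mul_le_mul_of_nonneg_right hu2' (sq_nonneg t)]
    have h3 : (162 * C + 2 * |κ| + 26 * |a|) * t ^ 4 ≤ (162 * C + 2 * |κ| + 26 * |a|) * t ^ 2 := by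
      gcongr ?_ * ?_
      linarith
    have h4 := mul_nonneg (abs_nonneg a) (sq_nonneg t)
    linarith

theorem inv_pow_eq_mul_rpow {a r p : ℝ} (n : ℕ) (ha : 0 ≤ a) (hr : 0 < r) (hp : 0 < p)
    (h : a ^ 2 = r ^ 2 * p) : (a ^ n)⁻¹ = (r ^ n)⁻¹ * p ^ (-((n : ℝ) / 2)) := by
  have key : ∀ b : ℝ, 0 ≤ b → (b ^ 2) ^ ((n : ℝ) / 2) = b ^ n := fun b hb => by
    rw [← Real.rpow_natCast b 2, ← Real.rpow_mul hb, ← Real.rpow_natCast b n]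
    congr 1; push_cast; ring
  rw [Real.rpow_neg hp.le, ← mul_inv, ← key a ha, ← key r hr.le, h,
    Real.mul_rpow (by positivity) hp.le]

/-- The Poisson-type kernel of the ball with centre `0` having `w` on its boundary; for `n = d` it
is the continuum Poisson kernel with pole `w`, up to normalization. -/
noncomputable def ballKernel {d : ℕ} (n : ℕ) (w v : EuclideanSpace ℝ (Fin d)) : ℝ :=
  (‖w‖ ^ 2 - ‖v‖ ^ 2) * (‖v - w‖ ^ n)⁻¹

theorem norm_add_single_sq {d : ℕ} (v : EuclideanSpace ℝ (Fin d)) (i : Fin d) (c : ℝ) :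
    ‖v + EuclideanSpace.single i c‖ ^ 2 = ‖v‖ ^ 2 + 2 * (c * v i) + c ^ 2 := by
  rw [norm_add_sq_real, EuclideanSpace.inner_single_right]
  simp

theorem ballKernel_add_single {d : ℕ} (n : ℕ) (w v : EuclideanSpace ℝ (Fin d)) (i : Fin d)
    (c : ℝ) (hc : c ^ 2 = 1) (hr : 0 < ‖v - w‖)
    (hp : 0 < 1 + (‖v - w‖⁻¹ ^ 2 + 2 * (c * ((v - w) i / ‖v - w‖)) * ‖v - w‖⁻¹)) :
    ballKernel n w (v + EuclideanSpace.single i c) =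
      (‖w‖ ^ 2 - ‖v‖ ^ 2 - 2 * (c * v i) - 1) * (‖v - w‖ ^ n)⁻¹ *
        (1 + (‖v - w‖⁻¹ ^ 2 + 2 * (c * ((v - w) i / ‖v - w‖)) * ‖v - w‖⁻¹))
          ^ (-((n : ℝ) / 2)) := by
  have h : ‖v + EuclideanSpace.single i c - w‖ ^ 2 = ‖v - w‖ ^ 2 *
      (1 + (‖v - w‖⁻¹ ^ 2 + 2 * (c * ((v - w) i / ‖v - w‖)) * ‖v - w‖⁻¹)) := by
    rw [add_sub_right_comm, norm_add_single_sq, hc]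
    field_simp
    ring
  rw [ballKernel, inv_pow_eq_mul_rpow n (norm_nonneg _) hr hp h, norm_add_single_sq, hc]
  ring

theorem norm_sq_sub_le {E : Type*} [SeminormedAddCommGroup E] {v w : E} (h : ‖v‖ ≤ ‖w‖) :
    ‖w‖ ^ 2 - ‖v‖ ^ 2 ≤ 2 * ‖w‖ * ‖v - w‖ := by
  have h1 := norm_sub_norm_le w v
  rw [norm_sub_rev] at h1
  nlinarith [norm_nonneg v, norm_nonneg w]

/-- The lattice Laplacian of `ballKernel` agrees with the continuum one up to an error that gains
three powers of the distance to the pole. -/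
theorem exists_laplacian_ballKernel_bound (d n : ℕ) :
    ∃ C R : ℝ, 0 < C ∧ 1 ≤ R ∧ ∀ w v : EuclideanSpace ℝ (Fin d), ‖v‖ ≤ ‖w‖ → R ≤ ‖v - w‖ →
      |∑ i, (ballKernel n w (v + EuclideanSpace.single i 1)
          + ballKernel n w (v + EuclideanSpace.single i (-1)) - 2 * ballKernel n w v)
        - ((n : ℝ) - d) * (2 + n * (‖w‖ ^ 2 - ‖v‖ ^ 2) / ‖v - w‖ ^ 2) * (‖v - w‖ ^ n)⁻¹|
      ≤ C * ‖w‖ * (‖v - w‖ ^ (n + 3))⁻¹ := by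
  obtain ⟨C, R, hC, hR, hb⟩ := exists_rpow_symm_difference_bounds ((n : ℝ) / 2)
  refine ⟨d * (6 * C) + 1, R, by positivity, hR, fun w v hvw hr => ?_⟩
  have hr0 : 0 < ‖v - w‖ := by linarith
  set r := ‖v - w‖ with hrdef
  set t := r⁻¹ with ht
  have htr : t * r = 1 := inv_mul_cancel₀ hr0.ne'
  have ht0 : 0 < t := inv_pos.2 hr0
  have htR : t * R ≤ 1 := by nlinarith
  set A := ‖w‖ ^ 2 - ‖v‖ ^ 2 with hA
  set β := (n : ℝ) / 2 with hβ
  have hA0 : 0 ≤ A := by rw [hA]; nlinarith [norm_nonneg v]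
  have hA1 : A ≤ 2 * ‖w‖ * r := norm_sq_sub_le hvw
  have hrw : r ≤ 2 * ‖w‖ := (norm_sub_le v w).trans (by linarith)
  have hcoord : ∀ (x : EuclideanSpace ℝ (Fin d)) i, |x i| ≤ ‖x‖ := fun x i =>
    PiLp.norm_apply_le x i
  have hsq : ∑ i, ((v - w) i / r) ^ 2 = 1 := by
    simp_rw [div_pow]
    rw [← Finset.sum_div, ← EuclideanSpace.real_norm_sq_eq, ← hrdef]
    field_simp
  have hcross : ∑ i, v i * ((v - w) i / r) = (r ^ 2 - A) / 2 * t := by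
    have h1 : ∑ i, v i * ((v - w) i / r) = (∑ i, v i * (v - w) i) * t := by
      rw [Finset.sum_mul]; exact Finset.sum_congr rfl fun i _ => by rw [ht]; ring
    have h2 : ∑ i, v i * (v - w) i = inner ℝ v (v - w) := by
      rw [PiLp.inner_apply]; exact Finset.sum_congr rfl fun i _ => by simp [mul_comm]
    have h3 := norm_sub_sq_real v (v - w)
    rw [sub_sub_cancel] at h3
    rw [h1, h2, hA]
    congr 1
    linarith
  have hmain : ((n : ℝ) - d) * (2 + n * A / r ^ 2) * (r ^ n)⁻¹ =
      ∑ i, (A * (-2 * β * t ^ 2 + 4 * β * (β + 1) * ((v - w) i / r) ^ 2 * t ^ 2)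
        + 8 * β * (v i * ((v - w) i / r)) * t - 2) * (r ^ n)⁻¹ := by
    have hlin : ∀ i, A * (-2 * β * t ^ 2 + 4 * β * (β + 1) * ((v - w) i / r) ^ 2 * t ^ 2)
        + 8 * β * (v i * ((v - w) i / r)) * t - 2 = (A * (-2 * β * t ^ 2) - 2)
          + A * (4 * β * (β + 1)) * t ^ 2 * ((v - w) i / r) ^ 2
          + 8 * β * t * (v i * ((v - w) i / r)) := fun i => by ring
    rw [← Finset.sum_mul, Finset.sum_congr rfl fun i _ => hlin i, Finset.sum_add_distrib,
      Finset.sum_add_distrib, ← Finset.mul_sum, ← Finset.mul_sum, hsq, hcross]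
    simp only [Finset.sum_const, Finset.card_univ, Fintype.card_fin, nsmul_eq_mul]
    congr 1
    rw [hβ, ht]
    field_simp
    ring
  rw [hmain, ← Finset.sum_sub_distrib]
  refine (Finset.abs_sum_le_sum_abs _ _).trans ?_
  have hterm : ∀ i, |ballKernel n w (v + EuclideanSpace.single i 1)
          + ballKernel n w (v + EuclideanSpace.single i (-1)) - 2 * ballKernel n w v
      - (A * (-2 * β * t ^ 2 + 4 * β * (β + 1) * ((v - w) i / r) ^ 2 * t ^ 2)
        + 8 * β * (v i * ((v - w) i / r)) * t - 2) * (r ^ n)⁻¹|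
      ≤ 6 * C * (‖w‖ * (r ^ (n + 3))⁻¹) := by
    intro i
    set u := (v - w) i / r with hu
    have hu1 : |u| ≤ 1 := by
      rw [hu, abs_div, abs_of_pos hr0, div_le_one hr0]; exact hcoord _ i
    obtain ⟨hp, hm, b1, b2, b3⟩ := hb u t hu1 ht0 htR
    have hm' : 1 + (t ^ 2 + 2 * (-1 * u) * t) = 1 + (t ^ 2 - 2 * u * t) := by ring
    have e1 := ballKernel_add_single n w v i 1 (by norm_num) hr0 (by rw [one_mul]; exact hp)
    have e2 := ballKernel_add_single n w v i (-1) (by norm_num) hr0 (hm'.symm ▸ hm)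
    rw [← hrdef, ← ht, ← hu, ← hA, ← hβ] at e1 e2
    rw [one_mul u] at e1
    rw [hm'] at e2
    rw [e1, e2, ballKernel, ← hA, ← hrdef]
    set p := (1 + (t ^ 2 + 2 * u * t)) ^ (-β)
    set m := (1 + (t ^ 2 - 2 * u * t)) ^ (-β)
    have hsplit : (A - 2 * (1 * v i) - 1) * (r ^ n)⁻¹ * p
        + (A - 2 * (-1 * v i) - 1) * (r ^ n)⁻¹ * m - 2 * (A * (r ^ n)⁻¹)
        - (A * (-2 * β * t ^ 2 + 4 * β * (β + 1) * u ^ 2 * t ^ 2)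
        + 8 * β * (v i * u) * t - 2) * (r ^ n)⁻¹ =
        (A * (p + m - 2 - (-2 * β * t ^ 2 + 4 * β * (β + 1) * u ^ 2 * t ^ 2))
          + (- (2 * v i)) * (p - m + 4 * β * u * t) + (-1) * (p + m - 2)) * (r ^ n)⁻¹ := by ring
    rw [hsplit, abs_mul, abs_of_pos (by positivity : 0 < (r ^ n)⁻¹)]
    have hvi : |v i| ≤ ‖w‖ := (hcoord v i).trans hvw
    have hbd : |A * (p + m - 2 - (-2 * β * t ^ 2 + 4 * β * (β + 1) * u ^ 2 * t ^ 2))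
          + (- (2 * v i)) * (p - m + 4 * β * u * t) + (-1) * (p + m - 2)|
        ≤ 6 * C * ‖w‖ * t ^ 3 := by
      refine (abs_add_three _ _ _).trans ?_
      rw [abs_mul, abs_mul, abs_mul, abs_of_nonneg hA0, abs_neg, abs_neg, abs_one, abs_mul, abs_two]
      have c1 := mul_le_mul hA1 b1 (abs_nonneg _) (by positivity)
      have c2 := mul_le_mul (mul_le_mul_of_nonneg_left hvi zero_le_two) b2 (abs_nonneg _)
        (by positivity)
      have c3 : C * t ^ 2 ≤ 2 * C * ‖w‖ * t ^ 3 := by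
        calc C * t ^ 2 = C * r * t ^ 3 := by linear_combination (-C * t ^ 2) * htr
          _ ≤ C * (2 * ‖w‖) * t ^ 3 := by gcongr
          _ = _ := by ring
      have c4 : 2 * ‖w‖ * r * (C * t ^ 4) = 2 * C * ‖w‖ * t ^ 3 := by
        linear_combination (2 * ‖w‖ * C * t ^ 3) * htr
      linarith
    calc _ ≤ 6 * C * ‖w‖ * t ^ 3 * (r ^ n)⁻¹ := by gcongr
      _ = _ := by rw [ht, pow_add]; field_simp
  refine (Finset.sum_le_sum fun i _ => hterm i).trans ?_
  simp only [Finset.sum_const, Finset.card_univ, Fintype.card_fin, nsmul_eq_mul]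
  have : 0 ≤ ‖w‖ * (r ^ (n + 3))⁻¹ := by positivity
  nlinarith

/-- The inclusion of the lattice into Euclidean space. -/
noncomputable def toEuclid {d : ℕ} (x : Fin d → ℤ) : EuclideanSpace ℝ (Fin d) :=
  WithLp.toLp 2 fun i => (x i : ℝ)

theorem norm_toEuclid {d : ℕ} (x : Fin d → ℤ) : ‖toEuclid x‖ = znorm x := by
  simp [toEuclid, EuclideanSpace.norm_eq, znorm]

theorem toEuclid_add {d : ℕ} (x y : Fin d → ℤ) :
    toEuclid (x + y) = toEuclid x + toEuclid y := by
  ext i; simp [toEuclid]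

theorem toEuclid_sub {d : ℕ} (x y : Fin d → ℤ) :
    toEuclid (x - y) = toEuclid x - toEuclid y := by
  ext i; simp [toEuclid]

theorem toEuclid_single {d : ℕ} (i : Fin d) (c : ℤ) :
    toEuclid (Pi.single i c) = EuclideanSpace.single i (c : ℝ) := by
  ext j
  by_cases h : j = i
  · subst h; simp [toEuclid]
  · simp [toEuclid, h]

theorem znorm_sq {d : ℕ} (x : Fin d → ℤ) : znorm x ^ 2 = ∑ i, (x i : ℝ) ^ 2 :=
  Real.sq_sqrt (Finset.sum_nonneg fun _ _ => sq_nonneg _)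

theorem znorm_nonneg {d : ℕ} (x : Fin d → ℤ) : 0 ≤ znorm x := Real.sqrt_nonneg _

theorem znorm_eq_one_iff {d : ℕ} (e : Fin d → ℤ) :
    znorm e = 1 ↔ ∃ i, ∃ s : ℤˣ, e = Pi.single i (s : ℤ) := by
  constructor
  · intro h
    have h1 : ∑ i, e i ^ 2 = 1 := by
      have := znorm_sq e
      rw [h] at this
      exact_mod_cast this.symm.trans (one_pow 2)
    obtain ⟨i, hi⟩ : ∃ i, e i ≠ 0 := by
      by_contra! hne
      simp [hne] at h1
    rw [← Finset.add_sum_erase _ _ (Finset.mem_univ i)] at h1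
    have hpos : 0 < e i ^ 2 := by positivity
    have hnn : 0 ≤ ∑ j ∈ Finset.univ.erase i, e j ^ 2 :=
      Finset.sum_nonneg fun _ _ => sq_nonneg _
    have hz : ∑ j ∈ Finset.univ.erase i, e j ^ 2 = 0 := by omega
    rw [Finset.sum_eq_zero_iff_of_nonneg fun _ _ => sq_nonneg _] at hz
    have hu : IsUnit (e i) := Int.isUnit_iff.2 (sq_eq_one_iff.1 (by omega))
    refine ⟨i, hu.unit, funext fun j => ?_⟩
    by_cases hj : j = i
    · subst hj; simp
    · simpa [hj] using hz j (by simp [hj])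
  · rintro ⟨i, s, rfl⟩
    rw [← norm_toEuclid, toEuclid_single]
    rcases Int.units_eq_one_or s with rfl | rfl <;> simp

theorem finite_setOf_znorm_le (d : ℕ) (L : ℝ) : {x : Fin d → ℤ | znorm x ≤ L}.Finite := by
  refine (Set.finite_Icc (fun _ => -⌈L⌉) (fun _ => ⌈L⌉)).subset fun x hx => ?_
  have h : ∀ i, |x i| ≤ ⌈L⌉ := fun i => by
    have h1 : |(x i : ℝ)| ≤ ⌈L⌉ :=
      calc |(x i : ℝ)| = ‖toEuclid x i‖ := rfl
        _ ≤ ‖toEuclid x‖ := PiLp.norm_apply_le _ i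
        _ = znorm x := norm_toEuclid x
        _ ≤ L := hx
        _ ≤ _ := Int.le_ceil L
    exact_mod_cast h1
  exact ⟨fun i => (abs_le.1 (h i)).1, fun i => (abs_le.1 (h i)).2⟩

/-- The sum of a function over the lattice neighbours of `x`. -/
def nbrSum {d : ℕ} (f : (Fin d → ℤ) → ℝ) (x : Fin d → ℤ) : ℝ :=
  ∑ p : Fin d × ℤˣ, f (x + Pi.single p.1 (p.2 : ℤ))

theorem le_nbrSum {d : ℕ} {f : (Fin d → ℤ) → ℝ} (hf : ∀ x, 0 ≤ f x) (x : Fin d → ℤ) (i : Fin d)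
    (s : ℤˣ) : f (x + Pi.single i (s : ℤ)) ≤ nbrSum f x :=
  Finset.single_le_sum (f := fun p : Fin d × ℤˣ => f (x + Pi.single p.1 (p.2 : ℤ)))
    (fun _ _ => hf _) (Finset.mem_univ (i, s))

/-- The minimum principle for discrete superharmonic functions on a finite set. -/
theorem nonneg_of_nbrSum_le {d : ℕ} (hd : 0 < d) {D : Set (Fin d → ℤ)} (hD : D.Finite)
    {φ : (Fin d → ℤ) → ℝ} (hsup : ∀ x ∈ D, nbrSum φ x ≤ 2 * d * φ x)
    (hbd : ∀ x ∈ D, ∀ p : Fin d × ℤˣ, x + Pi.single p.1 (p.2 : ℤ) ∉ D →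
      0 ≤ φ (x + Pi.single p.1 (p.2 : ℤ))) :
    ∀ x ∈ D, 0 ≤ φ x := by
  by_contra! hneg
  obtain ⟨x₁, hx₁, hφ₁⟩ := hneg
  obtain ⟨m, hm, hmin⟩ := Set.exists_min_image D φ hD ⟨x₁, hx₁⟩
  have hm0 : φ m < 0 := (hmin _ hx₁).trans_lt hφ₁
  obtain ⟨x, ⟨hxD, hxm⟩, hmax⟩ := Set.exists_max_image {x ∈ D | φ x = φ m} (fun x => x ⟨0, hd⟩)
    (hD.subset fun _ h => h.1) ⟨m, hm, rfl⟩
  have hge : ∀ p : Fin d × ℤˣ, φ m ≤ φ (x + Pi.single p.1 (p.2 : ℤ)) := fun p => by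
    by_cases h : x + Pi.single p.1 (p.2 : ℤ) ∈ D
    · exact hmin _ h
    · exact hm0.le.trans (hbd x hxD p h)
  have hcard : ∑ _p : Fin d × ℤˣ, φ m = 2 * d * φ m := by
    simp [Fintype.card_units_int]
    ring_nf
    simp
  have hsum : ∑ _p : Fin d × ℤˣ, φ m = nbrSum φ x :=
    le_antisymm (Finset.sum_le_sum fun p _ => hge p) (by rw [hcard, ← hxm]; exact hsup x hxD)
  have heq := (Finset.sum_eq_sum_iff_of_le fun p _ => hge p).1 hsum (⟨0, hd⟩, 1) (Finset.mem_univ _)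
  have hmem : x + Pi.single (⟨0, hd⟩ : Fin d) ((1 : ℤˣ) : ℤ) ∈ D := by
    by_contra h
    have := hbd x hxD (⟨0, hd⟩, 1) h
    linarith
  have := hmax _ ⟨hmem, heq.symm⟩
  simp at this

section RandomWalk

variable {d : ℕ}

/-- The event that the walk leaves the ball of radius `L` at the point `y`. -/
def exitEvent (L : ℝ) (y : Fin d → ℤ) : Set (ℕ → Fin d → ℤ) :=
  {ω | ∃ n : ℕ, ω n = y ∧ ∀ k < n, znorm (ω k) ≤ L}

theorem measurableSet_exitEvent (L : ℝ) (y : Fin d → ℤ) : MeasurableSet (exitEvent L y) := by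
  have : exitEvent L y = ⋃ n : ℕ, (fun ω : ℕ → Fin d → ℤ => ω n) ⁻¹' {y} ∩
      ⋂ k : ℕ, ⋂ _ : k < n, (fun ω : ℕ → Fin d → ℤ => ω k) ⁻¹' {x | znorm x ≤ L} := by
    ext ω; simp [exitEvent]
  rw [this]
  exact MeasurableSet.iUnion fun n => (measurable_pi_apply n (.singleton y)).inter
    (.iInter fun k => .iInter fun _ => measurable_pi_apply k (Set.to_countable _).measurableSet)

variable {P : (Fin d → ℤ) → Measure (ℕ → Fin d → ℤ)}

theorem IsMarkovChain.ae_start (hP : IsMarkovChain P) (x : Fin d → ℤ) :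
    ∀ᵐ ω ∂(P x), ω 0 = x := by
  have := hP.1 x
  have hmeas : MeasurableSet {ω : ℕ → Fin d → ℤ | ω 0 = x} :=
    measurable_pi_apply (X := fun _ : ℕ => Fin d → ℤ) 0 (MeasurableSet.singleton x)
  exact (mem_ae_iff_prob_eq_one hmeas).2 (hP.2.1 x)

/-- The probability that the walk started at `x` leaves the ball of radius `L` at `y`. -/
noncomputable def exitProb (P : (Fin d → ℤ) → Measure (ℕ → Fin d → ℤ)) (L : ℝ)
    (y x : Fin d → ℤ) : ℝ := (P x (exitEvent L y)).toReal

theorem exitProb_nonneg (L : ℝ) (y x : Fin d → ℤ) : 0 ≤ exitProb P L y x :=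
  ENNReal.toReal_nonneg

theorem exitProb_self (hP : IsMarkovChain P) (L : ℝ) (y : Fin d → ℤ) :
    exitProb P L y y = 1 := by
  have := hP.1 y
  have h : P y (exitEvent L y) = 1 := by
    refine (prob_compl_eq_zero_iff (measurableSet_exitEvent L y)).1 ?_
    filter_upwards [hP.ae_start y] with ω hω
    exact ⟨0, hω, by simp⟩
  simp [exitProb, h]

theorem exitProb_eq_zero (hP : IsMarkovChain P) {L : ℝ} {y x : Fin d → ℤ} (hx : L < znorm x)
    (hxy : x ≠ y) : exitProb P L y x = 0 := by
  have h : P x (exitEvent L y) = 0 := by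
    refine measure_mono_null (t := {ω | ω 0 = x}ᶜ) ?_ (hP.ae_start x)
    rintro ω ⟨n, hn, hk⟩ h0
    rcases Nat.eq_zero_or_pos n with rfl | hpos
    · exact hxy (h0.symm.trans hn)
    · exact (hk 0 hpos).not_gt (h0.symm ▸ hx)
  simp [exitProb, h]

theorem nbrSum_exitProb (hd : 0 < d) (hP : IsSRW d P) {L : ℝ} {y x : Fin d → ℤ}
    (hx : znorm x ≤ L) (hy : L < znorm y) :
    nbrSum (exitProb P L y) x = 2 * d * exitProb P L y x := by
  have hprob := hP.1.1
  have hxy : x ≠ y := fun h => (hx.trans_lt hy).ne (h ▸ rfl)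
  have hshift : P x (exitEvent L y) =
      P x (Set.univ ∩ {ω | (fun k => ω (1 + k)) ∈ exitEvent L y}) := by
    rw [Set.univ_inter]
    refine measure_congr ?_
    filter_upwards [hP.1.ae_start x] with ω hω
    refine propext ⟨?_, ?_⟩
    · rintro ⟨n, hn, hk⟩
      rcases n with _ | n
      · exact absurd (hω.symm.trans hn) hxy
      · exact ⟨n, by simpa [add_comm] using hn, fun k hk' => hk _ (by omega)⟩
    · rintro ⟨n, hn, hk⟩
      refine ⟨1 + n, hn, fun k hk' => ?_⟩
      rcases k with _ | k
      · exact hω.symm ▸ hx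
      · simpa [add_comm] using hk k (by omega)
  rw [hP.1.2.2 x 1 Set.univ _ .univ (measurableSet_exitEvent L y) (by simp),
    Measure.restrict_univ,
    ← lintegral_map (f := fun a => P a (exitEvent L y)) (g := fun ω : ℕ → Fin d → ℤ => ω 1)
      (measurable_of_countable _) (measurable_pi_apply 1), lintegral_countable'] at hshift
  have hstep : ∀ a, Measure.map (fun ω : ℕ → Fin d → ℤ => ω 1) (P x) {a} =
      if znorm (a - x) = 1 then ENNReal.ofReal (1 / (2 * d)) else 0 := fun a => by
    rw [Measure.map_apply (measurable_pi_apply 1) (.singleton a)]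
    exact hP.2 x a
  have hinj : Function.Injective fun p : Fin d × ℤˣ => x + Pi.single p.1 (p.2 : ℤ) := by
    rintro ⟨i, s⟩ ⟨j, t⟩ h
    have h1 : (Pi.single i (s : ℤ) : Fin d → ℤ) = Pi.single j (t : ℤ) := add_left_cancel h
    have hij : i = j := by
      by_contra hij
      have := congrFun h1 i
      simp [hij] at this
    subst hij
    have := congrFun h1 i
    simp only [Pi.single_eq_same, Units.val_inj] at this
    rw [this]
  simp_rw [hstep] at hshift
  rw [← hinj.tsum_eq, tsum_fintype] at hshift
  · have h2 : ∀ p : Fin d × ℤˣ, znorm (x + Pi.single p.1 (p.2 : ℤ) - x) = 1 := fun p => by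
      rw [add_sub_cancel_left, znorm_eq_one_iff]; exact ⟨_, _, rfl⟩
    simp only [h2, if_true] at hshift
    rw [← Finset.sum_mul] at hshift
    have h3 : exitProb P L y x = nbrSum (exitProb P L y) x * (1 / (2 * d)) := by
      rw [exitProb, hshift, ENNReal.toReal_mul, ENNReal.toReal_sum (fun _ _ => measure_ne_top _ _),
        ENNReal.toReal_ofReal (by positivity)]
      rfl
    rw [h3]
    field_simp
  · intro a ha
    have : znorm (a - x) = 1 := by
      by_contra hne
      simp [hne] at ha
    obtain ⟨i, s, hs⟩ := (znorm_eq_one_iff _).1 this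
    exact ⟨(i, s), by simp [← hs]⟩

theorem exitProb_nbr_le (hd : 0 < d) (hP : IsSRW d P) {L : ℝ} {y x : Fin d → ℤ}
    (hx : znorm x ≤ L) (hy : L < znorm y) (i : Fin d) (s : ℤˣ) :
    exitProb P L y (x + Pi.single i (s : ℤ)) / (2 * d) ≤ exitProb P L y x := by
  rw [div_le_iff₀ (by positivity), mul_comm (exitProb P L y x), ← nbrSum_exitProb hd hP hx hy]
  exact le_nbrSum (exitProb_nonneg L y) x i s

/-- Connecting `x` to the interior neighbour `z` of `y` by a lattice path inside the ball. -/
theorem exitProb_lower_of_path (hd : 0 < d) (hP : IsSRW d P) {L : ℝ} {y z : Fin d → ℤ}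
    (hz : znorm z ≤ L) (hy : L < znorm y) (hzy : znorm (y - z) = 1) (n : ℕ) :
    ∀ x : Fin d → ℤ, znorm x ≤ L → ∑ i, (x i - z i).natAbs = n →
      ((1 : ℝ) / (2 * d)) ^ (n + 1) ≤ exitProb P L y x := by
  induction n with
  | zero =>
    intro x hx hn
    have hxz : x = z := by
      funext i
      have := (Finset.sum_eq_zero_iff.1 hn) i (Finset.mem_univ i)
      omega
    subst hxz
    obtain ⟨i, s, hs⟩ := (znorm_eq_one_iff _).1 hzy
    have := exitProb_nbr_le hd hP hx hy i s
    rw [← hs, add_sub_cancel, exitProb_self hP.1] at this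
    simpa using this
  | succ n ih =>
    intro x hx hn
    obtain ⟨i, hi, hle⟩ : ∃ i, x i ≠ z i ∧ znorm (x + Pi.single i (z i - x i).sign) ≤ L := by
      by_cases hcase : ∃ i, x i ≠ z i ∧ (x i + (z i - x i).sign) ^ 2 ≤ x i ^ 2
      · obtain ⟨i, hi, hle⟩ := hcase
        refine ⟨i, hi, (Real.sqrt_le_sqrt (Finset.sum_le_sum fun j _ => ?_)).trans hx⟩
        by_cases hj : j = i
        · subst hj; simp only [Pi.add_apply, Pi.single_eq_same]; exact_mod_cast hle
        · simp [hj]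
      · push Not at hcase
        obtain ⟨i, hi⟩ : ∃ i, x i ≠ z i := by
          by_contra! hall
          simp [hall] at hn
        have hlt : ∀ j, x j ≠ z j → (x j + (z j - x j).sign) ^ 2 ≤ z j ^ 2 ∧ x j ^ 2 ≤ z j ^ 2 := by
          intro j hj
          have h1 := hcase j hj
          rcases lt_or_gt_of_ne hj with h | h
          · rw [Int.sign_eq_one_of_pos (by omega)] at h1 ⊢
            have : 0 ≤ x j := by nlinarith
            exact ⟨by nlinarith, by nlinarith⟩
          · rw [Int.sign_eq_neg_one_of_neg (by omega)] at h1 ⊢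
            have : x j ≤ 0 := by nlinarith
            exact ⟨by nlinarith, by nlinarith⟩
        refine ⟨i, hi, (Real.sqrt_le_sqrt (Finset.sum_le_sum fun j _ => ?_)).trans hz⟩
        by_cases hj : j = i
        · subst hj; simp only [Pi.add_apply, Pi.single_eq_same]; exact_mod_cast (hlt j hi).1
        · simp only [Pi.add_apply, Pi.single_eq_of_ne hj, add_zero]
          by_cases hjz : x j = z j
          · rw [hjz]
          · exact_mod_cast (hlt j hjz).2
    have hu : IsUnit (z i - x i).sign := by
      rcases lt_or_gt_of_ne hi with h | h
      · rw [Int.sign_eq_one_of_pos (by omega)]; exact isUnit_one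
      · rw [Int.sign_eq_neg_one_of_neg (by omega)]; exact isUnit_one.neg
    have hstep := exitProb_nbr_le hd hP hx hy i hu.unit
    rw [IsUnit.unit_spec] at hstep
    have hih := ih _ hle (by
      rw [← Finset.add_sum_erase _ _ (Finset.mem_univ i)] at hn ⊢
      rw [Finset.sum_congr rfl fun j hj => by
        rw [Pi.add_apply, Pi.single_eq_of_ne (Finset.ne_of_mem_erase hj), add_zero]]
      simp only [Pi.add_apply, Pi.single_eq_same]
      rcases lt_or_gt_of_ne hi with h | h
      · rw [Int.sign_eq_one_of_pos (by omega)]; omega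
      · rw [Int.sign_eq_neg_one_of_neg (by omega)]; omega)
    refine le_trans ?_ hstep
    rw [pow_succ, div_eq_mul_one_div (exitProb _ _ _ _)]
    gcongr

end RandomWalk

theorem nbrSum_eq {d : ℕ} (f : (Fin d → ℤ) → ℝ) (x : Fin d → ℤ) :
    nbrSum f x = ∑ i, (f (x + Pi.single i 1) + f (x + Pi.single i (-1))) := by
  rw [nbrSum, Fintype.sum_prod_type]
  refine Finset.sum_congr rfl fun i _ => ?_
  rw [UnitsInt.univ, Finset.sum_pair (by decide)]
  simp

theorem one_le_znorm {d : ℕ} {x : Fin d → ℤ} (hx : x ≠ 0) : 1 ≤ znorm x := by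
  obtain ⟨i, hi⟩ := Function.ne_iff.1 hx
  calc (1 : ℝ) ≤ |(x i : ℝ)| := by exact_mod_cast Int.one_le_abs hi
    _ = ‖toEuclid x i‖ := rfl
    _ ≤ ‖toEuclid x‖ := PiLp.norm_apply_le _ i
    _ = znorm x := norm_toEuclid x

theorem norm_toEuclid_single {d : ℕ} (i : Fin d) (s : ℤˣ) :
    ‖toEuclid (Pi.single i (s : ℤ))‖ = 1 := by
  rw [norm_toEuclid]
  exact (znorm_eq_one_iff _).2 ⟨i, s, rfl⟩

/-- The `ballKernel` restricted to the lattice. -/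
noncomputable def latticeKernel {d : ℕ} (n : ℕ) (w : EuclideanSpace ℝ (Fin d)) (x : Fin d → ℤ) :
    ℝ := ballKernel n w (toEuclid x)

theorem exists_nbrSum_latticeKernel_bound (d n : ℕ) :
    ∃ C R : ℝ, 0 < C ∧ 1 ≤ R ∧ ∀ (w : EuclideanSpace ℝ (Fin d)) (x : Fin d → ℤ),
      ‖toEuclid x‖ ≤ ‖w‖ → R ≤ ‖toEuclid x - w‖ →
      |nbrSum (latticeKernel n w) x - 2 * d * latticeKernel n w x
        - ((n : ℝ) - d) * (2 + n * (‖w‖ ^ 2 - ‖toEuclid x‖ ^ 2) / ‖toEuclid x - w‖ ^ 2)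
          * (‖toEuclid x - w‖ ^ n)⁻¹| ≤ C * ‖w‖ * (‖toEuclid x - w‖ ^ (n + 3))⁻¹ := by
  obtain ⟨C, R, hC, hR, h⟩ := exists_laplacian_ballKernel_bound d n
  refine ⟨C, R, hC, hR, fun w x hx hr => ?_⟩
  convert h w _ hx hr using 3
  rw [Finset.sum_sub_distrib, nbrSum_eq]
  simp [latticeKernel, toEuclid_add, toEuclid_single]
  ring

/-- The radial projection of `y` to the sphere of radius `ρ`. -/
noncomputable def radialProj {d : ℕ} (ρ : ℝ) (y : Fin d → ℤ) : EuclideanSpace ℝ (Fin d) :=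
  (ρ / znorm y) • toEuclid y

theorem norm_radialProj {d : ℕ} {ρ : ℝ} (hρ : 0 ≤ ρ) {y : Fin d → ℤ} (hy : 0 < znorm y) :
    ‖radialProj ρ y‖ = ρ := by
  rw [radialProj, norm_smul, norm_toEuclid, Real.norm_of_nonneg (by positivity)]
  field_simp

theorem norm_toEuclid_sub_radialProj {d : ℕ} (ρ : ℝ) {y : Fin d → ℤ} (hy : 0 < znorm y) :
    ‖toEuclid y - radialProj ρ y‖ = |znorm y - ρ| := by
  have h : toEuclid y - radialProj ρ y = (1 - ρ / znorm y) • toEuclid y := by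
    rw [radialProj, sub_smul, one_smul]
  rw [h, norm_smul, norm_toEuclid, Real.norm_eq_abs]
  nth_rewrite 2 [← abs_of_pos hy]
  rw [← abs_mul]
  congr 1
  field_simp

theorem nbrSum_sub_mul {d : ℕ} (f g : (Fin d → ℤ) → ℝ) (c : ℝ) (x : Fin d → ℤ) :
    nbrSum (fun x => f x - c * g x) x = nbrSum f x - c * nbrSum g x := by
  simp only [nbrSum, Finset.sum_sub_distrib, Finset.mul_sum]

section Bounds

variable {d : ℕ} {P : (Fin d → ℤ) → Measure (ℕ → Fin d → ℤ)}

theorem exists_exitProb_le (hd : 0 < d) (hP : IsSRW d P) :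
    ∃ C > (0 : ℝ), ∀ L : ℝ, 1 ≤ L → ∀ x y : Fin d → ℤ, znorm x ≤ L → L < znorm y →
      znorm y ≤ L + 1 → exitProb P L y x ≤ C * max 1 (L - znorm x) / znorm (x - y) ^ d := by
  obtain ⟨C₀, R₀, hC₀, hR₀, hb₀⟩ := exists_nbrSum_latticeKernel_bound d d
  obtain ⟨C₁, R₁, hC₁, hR₁, hb₁⟩ := exists_nbrSum_latticeKernel_bound d (d + 1)
  obtain ⟨S, hS⟩ : ∃ S, S = max (max R₀ R₁) (max (C₀ + C₁) 3) := ⟨_, rfl⟩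
  have hSR₀ : R₀ ≤ S := hS ▸ (le_max_left _ _).trans (le_max_left _ _)
  have hSR₁ : R₁ ≤ S := hS ▸ (le_max_right _ _).trans (le_max_left _ _)
  have hSC : C₀ + C₁ ≤ S := hS ▸ (le_max_left _ _).trans (le_max_right _ _)
  have hS3 : 3 ≤ S := hS ▸ (le_max_right _ _).trans (le_max_right _ _)
  clear hS
  refine ⟨2 * (1 + S) * (2 * S) ^ d, by positivity, fun L hL x y hx hy hy1 => ?_⟩
  have hy0 : 0 < znorm y := by linarith
  set ρ := L + S with hρ
  have hρ0 : 0 < ρ := by positivity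
  set w := radialProj ρ y
  have hw : ‖w‖ = ρ := norm_radialProj hρ0.le hy0
  have hdist : ∀ x : Fin d → ℤ, ρ - znorm x ≤ ‖toEuclid x - w‖ := fun x => by
    have := norm_sub_norm_le w (toEuclid x)
    rwa [norm_sub_rev, hw, norm_toEuclid] at this
  set f : (Fin d → ℤ) → ℝ := fun x => latticeKernel d w x - 1 * latticeKernel (d + 1) w x with hf
  have hf_eq : ∀ x, f x = (ρ ^ 2 - znorm x ^ 2) * (‖toEuclid x - w‖ ^ d)⁻¹
      * (1 - ‖toEuclid x - w‖⁻¹) := fun x => by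
    simp only [hf, latticeKernel, ballKernel, hw, norm_toEuclid]
    ring
  have hf_nonneg : ∀ x, znorm x ≤ L + 1 → 0 ≤ f x := fun x hx => by
    have hr : 1 ≤ ‖toEuclid x - w‖ := by linarith [hdist x]
    have h1 : 0 ≤ 1 - ‖toEuclid x - w‖⁻¹ := sub_nonneg.2 (inv_le_one_of_one_le₀ hr)
    have h2 : 0 ≤ ρ ^ 2 - znorm x ^ 2 := by nlinarith [znorm_nonneg x]
    rw [hf_eq]
    positivity
  have hf_super : ∀ x, znorm x ≤ L → nbrSum f x ≤ 2 * d * f x := fun x hx => by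
    have hr : S ≤ ‖toEuclid x - w‖ := by linarith [hdist x]
    have hxw : ‖toEuclid x‖ ≤ ‖w‖ := by rw [hw, norm_toEuclid]; linarith
    have e₀ := (abs_le.1 (hb₀ w x hxw (hSR₀.trans hr))).2
    have e₁ := (abs_le.1 (hb₁ w x hxw (hSR₁.trans hr))).1
    rw [hw, norm_toEuclid] at e₀ e₁
    rw [hf, nbrSum_sub_mul]
    simp only
    set r := ‖toEuclid x - w‖
    have hr0 : 0 < r := by linarith
    have hA : ρ * (C₀ + C₁) ≤ ρ ^ 2 - znorm x ^ 2 := by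
      have : ρ * S ≤ ρ ^ 2 - znorm x ^ 2 := by nlinarith [znorm_nonneg x]
      nlinarith
    set A := ρ ^ 2 - znorm x ^ 2
    have hA0 : 0 ≤ A := le_trans (by positivity) hA
    have hmain : A * (r ^ (d + 3))⁻¹ ≤ ((d + 1 : ℕ) - (d : ℝ)) * (2 + (d + 1 : ℕ) * A / r ^ 2)
        * (r ^ (d + 1))⁻¹ := by
      have : A * (r ^ (d + 3))⁻¹ = A / r ^ 2 * (r ^ (d + 1))⁻¹ := by
        rw [pow_add, pow_add]; field_simp
      rw [this]
      gcongr
      push_cast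
      have h1 : 0 ≤ A / r ^ 2 := by positivity
      have h2 : 0 ≤ d * (A / r ^ 2) := by positivity
      rw [mul_div_assoc]
      linarith
    have hdecay : (r ^ (d + 1 + 3))⁻¹ ≤ (r ^ (d + 3))⁻¹ := by
      gcongr ?_⁻¹
      exact pow_le_pow_right₀ (by linarith) (by omega)
    have h1 : C₁ * ρ * (r ^ (d + 1 + 3))⁻¹ ≤ C₁ * ρ * (r ^ (d + 3))⁻¹ := by gcongr
    have h2 : ρ * (C₀ + C₁) * (r ^ (d + 3))⁻¹ ≤ A * (r ^ (d + 3))⁻¹ := by gcongr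
    simp only [sub_self, zero_mul, sub_zero] at e₀
    linarith
  have hf_y : ρ * (S ^ d)⁻¹ ≤ f y := by
    have hq : ‖toEuclid y - w‖ = ρ - znorm y := by
      rw [norm_toEuclid_sub_radialProj ρ hy0, abs_sub_comm, abs_of_nonneg (by linarith)]
    rw [hf_eq, hq]
    set q := ρ - znorm y
    have hq2 : 2 ≤ q := by linarith
    have hqS : q ≤ S := by linarith
    have h1 : q⁻¹ ≤ 1 / 2 := by rw [inv_le_comm₀ (by linarith) (by norm_num)]; linarith
    have h2 : q * ρ ≤ ρ ^ 2 - znorm y ^ 2 := by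
      have : ρ ^ 2 - znorm y ^ 2 = q * (ρ + znorm y) := by ring
      rw [this]; gcongr; linarith
    have hA0 : 0 ≤ ρ ^ 2 - znorm y ^ 2 := le_trans (by positivity) h2
    calc ρ * (S ^ d)⁻¹ ≤ ρ * (q ^ d)⁻¹ := by gcongr
      _ = 2 * ρ * (q ^ d)⁻¹ * (1 / 2) := by ring
      _ ≤ (ρ ^ 2 - znorm y ^ 2) * (q ^ d)⁻¹ * (1 - q⁻¹) := by
        gcongr
        · nlinarith
        · linarith
  have hmin := nonneg_of_nbrSum_le hd (finite_setOf_znorm_le d L)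
    (φ := fun x => f x - ρ * (S ^ d)⁻¹ * exitProb P L y x)
    (fun x hx => by
      rw [nbrSum_sub_mul, nbrSum_exitProb hd hP hx hy]
      linarith [hf_super x hx])
    (fun x hx p hp => by
      by_cases hxy : x + Pi.single p.1 (p.2 : ℤ) = y
      · simp only [hxy, exitProb_self hP.1]
        linarith
      · simp only [exitProb_eq_zero hP.1 (not_le.1 hp) hxy, mul_zero, sub_zero]
        refine hf_nonneg _ ?_
        rw [← norm_toEuclid, toEuclid_add]
        refine (norm_add_le _ _).trans ?_
        rw [norm_toEuclid, norm_toEuclid_single]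
        exact add_le_add_left hx 1) x hx
  simp only [sub_nonneg] at hmin
  have hr : S ≤ ‖toEuclid x - w‖ := by linarith [hdist x]
  have hxy : znorm (x - y) ≤ 2 * ‖toEuclid x - w‖ := by
    rw [← norm_toEuclid, toEuclid_sub]
    have h1 := norm_sub_le_norm_sub_add_norm_sub (toEuclid x) w (toEuclid y)
    rw [norm_sub_rev w, norm_toEuclid_sub_radialProj ρ hy0, abs_sub_comm,
      abs_of_nonneg (by linarith)] at h1
    linarith
  have hxy0 : 0 < znorm (x - y) := by
    have : x - y ≠ 0 := fun h => by rw [sub_eq_zero.1 h] at hx; linarith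
    linarith [one_le_znorm this]
  set r := ‖toEuclid x - w‖
  have hr0 : 0 < r := by linarith
  have hδ : 0 < max 1 (L - znorm x) := by positivity
  have hA : ρ ^ 2 - znorm x ^ 2 ≤ 2 * ρ * ((1 + S) * max 1 (L - znorm x)) := by
    have h1 : ρ - znorm x ≤ (1 + S) * max 1 (L - znorm x) := by
      nlinarith [le_max_left 1 (L - znorm x), le_max_right 1 (L - znorm x)]
    have h2 : ρ ^ 2 - znorm x ^ 2 ≤ 2 * ρ * (ρ - znorm x) := by nlinarith [sq_nonneg (ρ - znorm x)]
    exact h2.trans (by gcongr)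
  have hA0 : 0 ≤ ρ ^ 2 - znorm x ^ 2 := by nlinarith [znorm_nonneg x]
  have hup : f x ≤ 2 * ρ * ((1 + S) * max 1 (L - znorm x)) * (2 ^ d * (znorm (x - y) ^ d)⁻¹) := by
    rw [hf_eq]
    have hpow : (r ^ d)⁻¹ ≤ 2 ^ d * (znorm (x - y) ^ d)⁻¹ := by
      rw [← div_eq_mul_inv, inv_le_comm₀ (by positivity) (by positivity), inv_div,
        div_le_iff₀ (by positivity), ← mul_pow, mul_comm r]
      gcongr
    have h1 : 1 - r⁻¹ ≤ 1 := by linarith [inv_pos.2 hr0]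
    calc _ ≤ (ρ ^ 2 - znorm x ^ 2) * (r ^ d)⁻¹ := mul_le_of_le_one_right (by positivity) h1
      _ ≤ _ := by gcongr
  have hfin := hmin.trans hup
  have hκ : 0 < ρ * (S ^ d)⁻¹ := by positivity
  refine le_of_mul_le_mul_left (hfin.trans_eq ?_) hκ
  rw [mul_pow]
  field_simp

end Bounds

theorem latticeKernel_eq {d : ℕ} (n : ℕ) (w : EuclideanSpace ℝ (Fin d)) (x : Fin d → ℤ) :
    latticeKernel n w x = (‖w‖ ^ 2 - znorm x ^ 2) * (‖toEuclid x - w‖ ^ n)⁻¹ := by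
  rw [latticeKernel, ballKernel, norm_toEuclid]

theorem abs_norm_toEuclid_add_single_sub_le {d : ℕ} (w : EuclideanSpace ℝ (Fin d))
    (x : Fin d → ℤ) (i : Fin d) (s : ℤˣ) :
    |‖toEuclid (x + Pi.single i (s : ℤ)) - w‖ - ‖toEuclid x - w‖| ≤ 1 := by
  refine (abs_norm_sub_norm_le _ _).trans_eq ?_
  rw [toEuclid_add, sub_sub_sub_cancel_right, add_sub_cancel_left, norm_toEuclid_single]

theorem znorm_add_single_sq {d : ℕ} (x : Fin d → ℤ) (i : Fin d) (s : ℤˣ) :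
    znorm (x + Pi.single i (s : ℤ)) ^ 2 = znorm x ^ 2 + 2 * ((s : ℤ) * x i) + 1 := by
  rw [← norm_toEuclid, toEuclid_add, toEuclid_single, norm_add_single_sq, norm_toEuclid]
  rcases Int.units_eq_one_or s with rfl | rfl <;> simp [toEuclid]

/-- Close to the sphere of radius `ρ`, some lattice step increases `|x|²` by a multiple of `ρ`. -/
theorem exists_outward_step {d : ℕ} (hd : 2 ≤ d) {ρ : ℝ} (hρ : 1 ≤ ρ) {x : Fin d → ℤ}
    (hx : ρ ^ 2 - znorm x ^ 2 ≤ ρ / d) :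
    ∃ (i : Fin d) (s : ℤˣ), ρ ^ 2 - znorm (x + Pi.single i (s : ℤ)) ^ 2 ≤ -(ρ / d) := by
  have hd' : (2 : ℝ) ≤ d := by exact_mod_cast hd
  obtain ⟨i, -, hi⟩ : ∃ i ∈ Finset.univ, znorm x ^ 2 / d ≤ (x i : ℝ) ^ 2 := by
    refine Finset.exists_le_of_sum_le ⟨⟨0, by omega⟩, Finset.mem_univ _⟩ ?_
    rw [← znorm_sq, Finset.sum_const, Finset.card_univ, Fintype.card_fin, nsmul_eq_mul]
    field_simp
    rfl
  have hz : ρ - 1 / d ≤ znorm x := by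
    refine le_of_sq_le_sq ?_ (znorm_nonneg x)
    have hu1 : (1 : ℝ) / d ≤ 1 := by rw [div_le_one (by positivity)]; linarith
    have hu0 : (0 : ℝ) ≤ 1 / d := by positivity
    rw [div_eq_mul_one_div] at hx
    nlinarith [mul_nonneg hu0 (by linarith : 0 ≤ ρ - 1 / d)]
  have habs : znorm x / d ≤ |(x i : ℝ)| := by
    refine le_of_sq_le_sq ?_ (abs_nonneg _)
    rw [sq_abs]
    refine le_trans ?_ hi
    rw [div_pow]
    gcongr
    nlinarith
  obtain ⟨s, hs⟩ : ∃ s : ℤˣ, ((s : ℤ) : ℝ) * x i = |(x i : ℝ)| := by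
    rcases le_total 0 (x i : ℝ) with h | h
    · exact ⟨1, by simp [abs_of_nonneg h]⟩
    · exact ⟨-1, by simp [abs_of_nonpos h]⟩
  refine ⟨i, s, ?_⟩
  rw [znorm_add_single_sq, hs]
  have h1 : ρ / d - 1 / d / d ≤ znorm x / d := by
    rw [← sub_div]; gcongr
  have h2 : (1 : ℝ) / d / d ≤ 1 / 2 := by
    rw [div_div, div_le_div_iff₀ (by positivity) (by norm_num)]; nlinarith
  linarith

/-- The positive part of a suitable combination of lattice kernels is subharmonic in the ball, away
from the pole. -/
theorem exists_subharmonic_barrier {d : ℕ} (hd : 2 ≤ d) :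
    ∃ M R : ℝ, 0 < M ∧ 2 ≤ R ∧ ∀ (w : EuclideanSpace ℝ (Fin d)) (x : Fin d → ℤ),
      1 ≤ ‖w‖ → znorm x ≤ ‖w‖ → R ≤ ‖toEuclid x - w‖ →
      2 * d * (latticeKernel d w x + M * latticeKernel (d + 1) w x) ≤
        nbrSum (fun z => max (latticeKernel d w z + M * latticeKernel (d + 1) w z) 0) x := by
  have hd0 : (0 : ℝ) < d := by positivity
  obtain ⟨C₀, R₀, hC₀, hR₀, hb₀⟩ := exists_nbrSum_latticeKernel_bound d d
  obtain ⟨C₁, R₁, hC₁, hR₁, hb₁⟩ := exists_nbrSum_latticeKernel_bound d (d + 1)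
  obtain ⟨M, hM⟩ : ∃ M, M = 2 * C₀ * d := ⟨_, rfl⟩
  have hM0 : 0 < M := by rw [hM]; positivity
  obtain ⟨R, hR⟩ : ∃ R, R = max (max R₀ R₁) (max (C₁ * M / C₀) (max (2 * C₀ * d * 2 ^ d) 2)) :=
    ⟨_, rfl⟩
  have hRR₀ : R₀ ≤ R := hR ▸ (le_max_left _ _).trans (le_max_left _ _)
  have hRR₁ : R₁ ≤ R := hR ▸ (le_max_right _ _).trans (le_max_left _ _)
  have hRC₁ : C₁ * M / C₀ ≤ R := hR ▸ (le_max_left _ _).trans (le_max_right _ _)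
  have hRC₀ : 2 * C₀ * d * 2 ^ d ≤ R :=
    hR ▸ (le_max_left _ _).trans ((le_max_right _ _).trans (le_max_right _ _))
  have hR2 : 2 ≤ R :=
    hR ▸ (le_max_right _ _).trans ((le_max_right _ _).trans (le_max_right _ _))
  clear hR
  refine ⟨M, R, hM0, hR2, fun w x hw1 hx hr => ?_⟩
  have hxw : ‖toEuclid x‖ ≤ ‖w‖ := by rwa [norm_toEuclid]
  have e₀ := (abs_le.1 (hb₀ w x hxw (hRR₀.trans hr))).1
  have e₁ := (abs_le.1 (hb₁ w x hxw (hRR₁.trans hr))).1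
  rw [norm_toEuclid] at e₀ e₁
  set g : (Fin d → ℤ) → ℝ := fun z => latticeKernel d w z + M * latticeKernel (d + 1) w z with hg
  have hgsum : nbrSum g x = nbrSum (latticeKernel d w) x
      + M * nbrSum (latticeKernel (d + 1) w) x := by
    simp only [nbrSum, hg, Finset.sum_add_distrib, Finset.mul_sum]
  have hstep : ∀ i s, ‖toEuclid (x + Pi.single i ((s : ℤˣ) : ℤ)) - w‖ ≤ ‖toEuclid x - w‖ + 1 ∧
      ‖toEuclid x - w‖ - 1 ≤ ‖toEuclid (x + Pi.single i ((s : ℤˣ) : ℤ)) - w‖ := fun i s => by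
    have := abs_le.1 (abs_norm_toEuclid_add_single_sub_le w x i s)
    constructor <;> linarith
  set r := ‖toEuclid x - w‖
  set ρ := ‖w‖
  have hr0 : 0 < r := by linarith
  set A := ρ ^ 2 - znorm x ^ 2 with hA
  have hA0 : 0 ≤ A := by nlinarith [znorm_nonneg x]
  have hmain : (d + 1) * A * (r ^ (d + 3))⁻¹ ≤ ((d + 1 : ℕ) - (d : ℝ))
      * (2 + (d + 1 : ℕ) * A / r ^ 2) * (r ^ (d + 1))⁻¹ := by
    have : (d + 1) * A * (r ^ (d + 3))⁻¹ = (d + 1) * A / r ^ 2 * (r ^ (d + 1))⁻¹ := by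
      rw [pow_add, pow_add]; field_simp
    rw [this]
    gcongr
    push_cast
    linarith
  have hdecay : M * (C₁ * ρ * (r ^ (d + 1 + 3))⁻¹) ≤ C₀ * ρ * (r ^ (d + 3))⁻¹ := by
    have h1 : C₁ * M ≤ C₀ * r := by
      rw [div_le_iff₀ hC₀] at hRC₁
      nlinarith
    calc M * (C₁ * ρ * (r ^ (d + 1 + 3))⁻¹) = C₁ * M * ρ * (r ^ (d + 1 + 3))⁻¹ := by ring
      _ ≤ C₀ * r * ρ * (r ^ (d + 1 + 3))⁻¹ := by gcongr
      _ = C₀ * ρ * (r ^ (d + 3))⁻¹ := by rw [add_right_comm, pow_succ _ (d + 3)]; field_simp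
  have hlow : 2 * d * g x + M * ((d + 1) * A * (r ^ (d + 3))⁻¹) - 2 * (C₀ * ρ * (r ^ (d + 3))⁻¹)
      ≤ nbrSum g x := by
    have h1 := mul_le_mul_of_nonneg_left e₁ hM0.le
    have h2 := mul_le_mul_of_nonneg_left hmain hM0.le
    rw [hgsum]
    simp only [sub_self, zero_mul, sub_zero] at e₀
    simp only [hg]
    linarith
  have hsplit : nbrSum (fun z => max (g z) 0) x = nbrSum g x + nbrSum (fun z => max (-g z) 0) x := by
    rw [nbrSum, nbrSum, nbrSum, ← Finset.sum_add_distrib]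
    refine Finset.sum_congr rfl fun p _ => ?_
    rcases le_total 0 (g (x + Pi.single p.1 (p.2 : ℤ))) with h | h
    · rw [max_eq_left h, max_eq_right (by linarith), add_zero]
    · rw [max_eq_right h, max_eq_left (by linarith), add_neg_cancel]
  rw [hsplit]
  refine le_trans ?_ (add_le_add_left hlow _)
  have hnn : 0 ≤ nbrSum (fun z => max (-g z) 0) x := Finset.sum_nonneg fun _ _ => le_max_right _ _
  rcases le_total (ρ / d) A with hcase | hcase
  · have h1 : 2 * (C₀ * ρ) ≤ M * ((d + 1) * A) := by
      calc 2 * (C₀ * ρ) = M * (ρ / d) := by rw [hM]; field_simp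
        _ ≤ M * ((d + 1) * A) := by gcongr; nlinarith
    have h2 : 2 * (C₀ * ρ) * (r ^ (d + 3))⁻¹ ≤ M * ((d + 1) * A) * (r ^ (d + 3))⁻¹ := by gcongr
    linarith
  · obtain ⟨i, s, his⟩ := exists_outward_step hd hw1 hcase
    have h1 : -g (x + Pi.single i (s : ℤ)) ≤ nbrSum (fun z => max (-g z) 0) x :=
      (le_max_left _ 0).trans
        (le_nbrSum (f := fun z => max (-g z) 0) (fun _ => le_max_right _ _) x i s)
    have h2 : ρ / d * ((2 * r) ^ d)⁻¹ ≤ -g (x + Pi.single i (s : ℤ)) := by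
      simp only [hg, latticeKernel_eq]
      obtain ⟨hs1, hs2⟩ := hstep i s
      set r' := ‖toEuclid (x + Pi.single i (s : ℤ)) - w‖
      have hr' : 0 < r' := by linarith
      have h3 : ρ / d * ((2 * r) ^ d)⁻¹ ≤
          -(ρ ^ 2 - znorm (x + Pi.single i (s : ℤ)) ^ 2) * (r' ^ d)⁻¹ := by
        gcongr
        · linarith
        · linarith
        · linarith
      have h4 : 0 ≤ M * (-(ρ ^ 2 - znorm (x + Pi.single i (s : ℤ)) ^ 2) * (r' ^ (d + 1))⁻¹) := by
        have : 0 ≤ -(ρ ^ 2 - znorm (x + Pi.single i (s : ℤ)) ^ 2) :=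
          le_trans (by positivity) (le_neg_of_le_neg his)
        positivity
      linarith
    have h3 : 2 * (C₀ * ρ * (r ^ (d + 3))⁻¹) ≤ ρ / d * ((2 * r) ^ d)⁻¹ := by
      have hr3 : 2 * C₀ * d * 2 ^ d ≤ r ^ 3 := by
        have : r ≤ r ^ 3 := le_self_pow₀ (by linarith) (by norm_num)
        linarith
      rw [pow_add, mul_pow]
      field_simp
      linarith
    have h4 : 0 ≤ M * ((d + 1) * A * (r ^ (d + 3))⁻¹) := by positivity
    linarith

section LowerBound

variable {d : ℕ} {P : (Fin d → ℤ) → Measure (ℕ → Fin d → ℤ)}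

theorem exitProb_ge_of_znorm_sub_le (hd : 0 < d) (hP : IsSRW d P) {L R : ℝ}
    {x y z : Fin d → ℤ} (hx : znorm x ≤ L) (hy : L < znorm y) (hz : znorm z ≤ L)
    (hzy : znorm (y - z) = 1) (hxy : znorm (x - y) ≤ R) :
    ((1 : ℝ) / (2 * d)) ^ (⌈d * (R + 1)⌉₊ + 1) ≤ exitProb P L y x := by
  have hd1 : (1 : ℝ) ≤ d := by exact_mod_cast hd
  have hxz : znorm (x - z) ≤ R + 1 := by
    have h := norm_add_le (toEuclid (x - y)) (toEuclid (y - z))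
    rw [← toEuclid_add, sub_add_sub_cancel] at h
    simp only [norm_toEuclid] at h
    linarith
  have hn : ∑ i, (x i - z i).natAbs ≤ ⌈d * (R + 1)⌉₊ := by
    have : ((∑ i, (x i - z i).natAbs : ℕ) : ℝ) ≤ d * (R + 1) := by
      push_cast
      calc ∑ i, (((x i - z i).natAbs : ℕ) : ℝ) ≤ ∑ _i : Fin d, znorm (x - z) := by
            refine Finset.sum_le_sum fun i _ => ?_
            calc (((x i - z i).natAbs : ℕ) : ℝ) = ‖toEuclid (x - z) i‖ := by
                  rw [Nat.cast_natAbs]; simp [toEuclid]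
              _ ≤ ‖toEuclid (x - z)‖ := PiLp.norm_apply_le _ i
              _ = znorm (x - z) := norm_toEuclid _
        _ = d * znorm (x - z) := by simp
        _ ≤ d * (R + 1) := by gcongr
    exact_mod_cast this.trans (Nat.le_ceil _)
  refine le_trans ?_ (exitProb_lower_of_path hd hP hz hy hzy _ x hx rfl)
  refine pow_le_pow_of_le_one (by positivity) ?_ (by omega)
  rw [div_le_one (by positivity)]
  linarith

theorem exists_exitProb_ge (hd : 2 ≤ d) (hP : IsSRW d P) :
    ∃ c > (0 : ℝ), ∀ L : ℝ, 1 ≤ L → ∀ x y z : Fin d → ℤ, znorm x ≤ L → L < znorm y →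
      znorm z ≤ L → znorm (y - z) = 1 →
      c * (L - znorm x) / znorm (x - y) ^ d ≤ exitProb P L y x := by
  have hd0 : 0 < d := by omega
  obtain ⟨M, R, hM, hR, hsub⟩ := exists_subharmonic_barrier hd
  obtain ⟨c₀, hc₀⟩ : ∃ c₀ : ℝ, c₀ = (1 / (2 * d)) ^ (⌈d * (R + 1 + 1)⌉₊ + 1) := ⟨_, rfl⟩
  have hc₀0 : 0 < c₀ := by rw [hc₀]; positivity
  have hnear : ∀ {L : ℝ} {x y z : Fin d → ℤ}, znorm x ≤ L → L < znorm y → znorm z ≤ L →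
      znorm (y - z) = 1 → znorm (x - y) ≤ R + 1 → c₀ ≤ exitProb P L y x :=
    fun hx hy hz hzy hxy => hc₀ ▸ exitProb_ge_of_znorm_sub_le hd0 hP hx hy hz hzy hxy
  refine ⟨c₀ / (2 * (1 + M) * 2 ^ d), by positivity, fun L hL x y z hx hy hz hzy => ?_⟩
  have hy0 : 0 < znorm y := by linarith
  have hyL : znorm y ≤ L + 1 := by
    have h := norm_add_le (toEuclid (y - z)) (toEuclid z)
    rw [← toEuclid_add, sub_add_cancel] at h
    simp only [norm_toEuclid] at h
    linarith
  have hw : ‖radialProj L y‖ = L := norm_radialProj (by linarith) hy0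
  have hyw : ‖toEuclid y - radialProj L y‖ ≤ 1 := by
    rw [norm_toEuclid_sub_radialProj L hy0, abs_of_nonneg (by linarith)]
    linarith
  generalize radialProj L y = w at hw hyw
  have hupper : ∀ x, znorm (x - y) ≤ ‖toEuclid x - w‖ + 1 := fun x => by
    rw [← norm_toEuclid, toEuclid_sub]
    have := norm_sub_le_norm_sub_add_norm_sub (toEuclid x) w (toEuclid y)
    rw [norm_sub_rev w] at this
    linarith
  have hxy1 : 1 ≤ znorm (x - y) :=
    one_le_znorm fun h => by rw [sub_eq_zero.1 h] at hx; linarith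
  have hδ : L - znorm x ≤ znorm (x - y) := by
    have := norm_sub_norm_le (toEuclid y) (toEuclid x)
    rw [norm_sub_rev, ← toEuclid_sub] at this
    simp only [norm_toEuclid] at this
    linarith
  have h2d : (1 : ℝ) ≤ 2 ^ d := one_le_pow₀ (by norm_num)
  rcases lt_or_ge ‖toEuclid x - w‖ R with hr | hr
  · have hp := hnear hx hy hz hzy ((hupper x).trans (by linarith))
    refine le_trans ?_ hp
    rw [div_le_iff₀ (by positivity)]
    calc c₀ / (2 * (1 + M) * 2 ^ d) * (L - znorm x) ≤ c₀ * znorm (x - y) := by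
          gcongr
          refine div_le_self hc₀0.le ?_
          nlinarith
      _ ≤ c₀ * znorm (x - y) ^ d := by
          gcongr
          exact le_self_pow₀ hxy1 (by omega)
  set g : (Fin d → ℤ) → ℝ := fun z => latticeKernel d w z + M * latticeKernel (d + 1) w z with hg
  have hg_eq : ∀ x, g x = (L ^ 2 - znorm x ^ 2) * ((‖toEuclid x - w‖ ^ d)⁻¹
      + M * (‖toEuclid x - w‖ ^ (d + 1))⁻¹) := fun x => by
    simp only [hg, latticeKernel_eq, hw]
    ring
  set κ := c₀ / (2 * L * (1 + M)) with hκ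
  have hκ0 : 0 < κ := by positivity
  have hmin := nonneg_of_nbrSum_le hd0
    (D := {x | znorm x ≤ L ∧ R ≤ ‖toEuclid x - w‖})
    ((finite_setOf_znorm_le d L).subset fun _ h => h.1)
    (φ := fun x => exitProb P L y x - κ * max (g x) 0)
    (fun x ⟨hx, hr⟩ => by
      have hA : 0 ≤ L ^ 2 - znorm x ^ 2 := by nlinarith [znorm_nonneg x]
      have hgx : 0 ≤ g x := by rw [hg_eq]; positivity
      rw [nbrSum_sub_mul, nbrSum_exitProb hd0 hP hx hy, max_eq_left hgx]
      have := mul_le_mul_of_nonneg_left (hsub w x (hw ▸ hL) (hw ▸ hx) hr) hκ0.le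
      simp only [hg] at this ⊢
      linarith)
    (fun x ⟨hx, hr⟩ p hp => by
      have hstep := (abs_le.1 (abs_norm_toEuclid_add_single_sub_le w x p.1 p.2)).1
      generalize x + Pi.single p.1 (p.2 : ℤ) = x' at hp hstep
      have hr' : 1 ≤ ‖toEuclid x' - w‖ := by linarith
      rcases lt_or_ge L (znorm x') with hx' | hx'
      · have hA : L ^ 2 - znorm x' ^ 2 ≤ 0 := by nlinarith
        have : g x' ≤ 0 := by
          rw [hg_eq]; exact mul_nonpos_of_nonpos_of_nonneg hA (by positivity)
        simp only [max_eq_right this, mul_zero, sub_zero]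
        exact exitProb_nonneg _ _ _
      · have hrR : ‖toEuclid x' - w‖ ≤ R := by
          by_contra! h
          exact hp ⟨hx', h.le⟩
        have hprob := hnear hx' hy hz hzy ((hupper x').trans (by linarith))
        have hgle : g x' ≤ 2 * L * (1 + M) := by
          have hA : L ^ 2 - znorm x' ^ 2 ≤ 2 * L * ‖toEuclid x' - w‖ := by
            have := norm_sq_sub_le (v := toEuclid x') (w := w) (by rwa [norm_toEuclid, hw])
            rwa [norm_toEuclid, hw] at this
          rw [hg_eq]
          set r := ‖toEuclid x' - w‖
          have hr0 : 0 < r := by linarith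
          have h1 : (r ^ d)⁻¹ ≤ r⁻¹ := by
            gcongr
            exact le_self_pow₀ hr' (by omega)
          have h2 : (r ^ (d + 1))⁻¹ ≤ r⁻¹ := by
            gcongr
            exact le_self_pow₀ hr' (by omega)
          calc _ ≤ 2 * L * r * (r⁻¹ + M * r⁻¹) := by gcongr
            _ = 2 * L * (1 + M) := by field_simp
        have hmax : max (g x') 0 ≤ 2 * L * (1 + M) := max_le hgle (by positivity)
        have : κ * max (g x') 0 ≤ c₀ := by
          calc κ * max (g x') 0 ≤ κ * (2 * L * (1 + M)) := by gcongr
            _ = c₀ := by rw [hκ]; field_simp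
        linarith) x ⟨hx, hr⟩
  simp only [sub_nonneg] at hmin
  refine le_trans ?_ hmin
  have hle : ‖toEuclid x - w‖ ≤ 2 * znorm (x - y) := by
    have := norm_sub_le_norm_sub_add_norm_sub (toEuclid x) (toEuclid y) w
    rw [← toEuclid_sub, norm_toEuclid] at this
    linarith
  have hlow : L * (L - znorm x) * (‖toEuclid x - w‖ ^ d)⁻¹ ≤ g x := by
    rw [hg_eq]
    set r := ‖toEuclid x - w‖
    have hr0 : 0 < r := by linarith
    have hA : L * (L - znorm x) ≤ L ^ 2 - znorm x ^ 2 := by nlinarith [znorm_nonneg x]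
    have : 0 ≤ L ^ 2 - znorm x ^ 2 := by nlinarith [znorm_nonneg x]
    gcongr
    exact le_add_of_nonneg_right (by positivity)
  set r := ‖toEuclid x - w‖
  have hr0 : 0 < r := by linarith
  have hL0 : 0 ≤ L - znorm x := by linarith
  have hpow : ((2 * znorm (x - y)) ^ d)⁻¹ ≤ (r ^ d)⁻¹ := by gcongr
  calc c₀ / (2 * (1 + M) * 2 ^ d) * (L - znorm x) / znorm (x - y) ^ d
      = κ * (L * (L - znorm x) * ((2 * znorm (x - y)) ^ d)⁻¹) := by
        rw [hκ, mul_pow]; field_simp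
    _ ≤ κ * (L * (L - znorm x) * (r ^ d)⁻¹) := by gcongr
    _ ≤ κ * g x := by gcongr
    _ ≤ κ * max (g x) 0 := by gcongr; exact le_max_left _ _

end LowerBound

/-- For `d ≥ 3` there is a constant `C > 0` such that for every
`L ≥ 1`, every `x ∈ V_L` and every `y` in the outer boundary `∂V_L`, the exit
measure `π_L(x,y)` of simple random walk from `V_L` satisfies
`C⁻¹ d_L(x)/|x-y|^d ≤ π_L(x,y) ≤ C max(1, d_L(x))/|x-y|^d`, where `d_L(x) = L - |x|`. -/
theorem stmt8 (d : ℕ) (hd : 3 ≤ d)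
    (P : (Fin d → ℤ) → Measure (ℕ → Fin d → ℤ)) (hP : IsSRW d P) :
    ∃ C > (0 : ℝ), ∀ L : ℝ, 1 ≤ L → ∀ x y : Fin d → ℤ,
      znorm x ≤ L → L < znorm y →
      (∃ e : Fin d → ℤ, znorm e = 1 ∧ znorm (y + e) ≤ L) →
      ENNReal.ofReal (C⁻¹ * (L - znorm x) / znorm (x - y) ^ d)
          ≤ P x {ω | ∃ n : ℕ, ω n = y ∧ ∀ k < n, znorm (ω k) ≤ L} ∧
      P x {ω | ∃ n : ℕ, ω n = y ∧ ∀ k < n, znorm (ω k) ≤ L}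
          ≤ ENNReal.ofReal (C * max 1 (L - znorm x) / znorm (x - y) ^ d) := by
  have hd0 : 0 < d := by omega
  obtain ⟨C, hC, hup⟩ := exists_exitProb_le hd0 hP
  obtain ⟨c, hc, hlow⟩ := exists_exitProb_ge (by omega) hP
  refine ⟨max C c⁻¹, lt_max_of_lt_left hC, fun L hL x y hx hy ⟨e, he, hye⟩ => ?_⟩
  have := hP.1.1 x
  have hpow : 0 ≤ znorm (x - y) ^ d := pow_nonneg (znorm_nonneg _) d
  have hyL : znorm y ≤ L + 1 := by
    have h := norm_sub_le (toEuclid (y + e)) (toEuclid e)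
    rw [← toEuclid_sub, add_sub_cancel_right] at h
    simp only [norm_toEuclid] at h
    linarith
  have hzy : znorm (y - (y + e)) = 1 := by
    rw [← norm_toEuclid, toEuclid_sub, toEuclid_add, sub_add_cancel_left, norm_neg, norm_toEuclid, he]
  constructor
  · refine (ENNReal.ofReal_le_iff_le_toReal (measure_ne_top _ _)).2
      (le_trans ?_ (hlow L hL x y (y + e) hx hy hye hzy))
    have : (max C c⁻¹)⁻¹ ≤ c := inv_le_of_inv_le₀ hc (le_max_right _ _)
    gcongr
  · refine (ENNReal.le_ofReal_iff_toReal_le (measure_ne_top _ _) (by positivity)).2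
      ((hup L hL x y hx hy hyL).trans ?_)
    gcongr
    exact le_max_left _ _
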